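/- arXiv:1405.7886 — 2 statements merged into one kernel-verified Lean document; each statement's English description precedes it below -/
import Mathlib

section
/- Let e₁, e₂, e₃ ∈ ℝ⁸ be orthonormal and let e₅ ∈ ℝ⁸ be a unit vector orthogonal to e₁, e₂, e₃ and to e₁×e₂×e₃. Define e₄ := −(e₁×e₂×e₃), e₆ := −(e₁×e₂×e₅), e₇ := −(e₁×e₃×e₅), e₈ := e₂×e₃×e₅. Then (e₁,…,e₈) is an orthonormal basis of ℝ⁸ and is a Spin(7)-frame, i.e. Φ₀(e_i,e_j,e_k,e_l) = Φ₀(u_i,u_j,u_k,u_l) for all 1 ≤ i<j<k<l ≤ 8, where (u₁,…,u₈) is the standard basis. Moreover e₄, e₆, e₇, e₈ are uniquely determined: if f₄, f₆, f₇, f₈ ∈ ℝ⁸ are such that (e₁,e₂,e₃,f₄,e₅,f₆,f₇,f₈) is a Spin(7)-frame, then f₄ = e₄, f₆ = e₆, f₇ = e₇, f₈ = e₈. -/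
open scoped RealInnerProductSpace

noncomputable section

abbrev E8 := EuclideanSpace ℝ (Fin 8)

/-- The 4-form `dx_{ijkl}` on `ℝ⁸`. -/
def dx4 (i j k l : Fin 8) (v : Fin 4 → E8) : ℝ :=
  Matrix.det (Matrix.of fun r s : Fin 4 => v s (![i, j, k, l] r))

/-- The Cayley 4-form `Φ₀` on `ℝ⁸`. -/
def Phi0 (v : Fin 4 → E8) : ℝ :=
  dx4 0 1 2 3 v + dx4 0 1 4 5 v - dx4 0 1 6 7 v + dx4 0 2 4 6 v + dx4 0 2 5 7 v
    + dx4 0 3 4 7 v - dx4 0 3 5 6 v - dx4 1 2 4 7 v + dx4 1 2 5 6 v + dx4 1 3 4 6 v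
    + dx4 1 3 5 7 v - dx4 2 3 4 5 v + dx4 2 3 6 7 v + dx4 4 5 6 7 v

/-- The Cayley form applied to four vectors. -/
def Phi (a b c d : E8) : ℝ := Phi0 ![a, b, c, d]

/-- The `i`-th standard basis vector of `ℝ⁸`. -/
def stdB (i : Fin 8) : E8 := EuclideanSpace.single i 1

/-- The triple cross product: the unique vector with `⟪x, u×v×w⟫ = Φ₀(x,u,v,w)`
for all `x`. -/
def crossTriple (u v w : E8) : E8 :=
  (EuclideanSpace.equiv (Fin 8) ℝ).symm fun i => Phi (stdB i) u v w

/-- A 4-dimensional subspace of `ℝ⁸` is Cayley if it has an orthonormal basis on which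
`Φ₀` takes the value `1`. -/
def IsCayley (V : Submodule ℝ E8) : Prop :=
  Module.finrank ℝ V = 4 ∧
    ∃ v : Fin 4 → E8, (∀ i, v i ∈ V) ∧ Orthonormal ℝ v ∧ Phi0 v = 1

/-- A family `(e₁,…,e₈)` is a `Spin(7)`-frame if `Φ₀` takes the same values on it as on
the standard basis, for all increasing quadruples of indices. -/
def IsSpin7Frame (e : Fin 8 → E8) : Prop :=
  ∀ i j k l : Fin 8, i < j → j < k → k < l →
    Phi (e i) (e j) (e k) (e l) = Phi (stdB i) (stdB j) (stdB k) (stdB l)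

/-- The `(i, j)` Plücker coordinate of `a ∧ b`. -/
def plucker (a b : E8) (i j : Fin 8) : ℝ := a i * b j - a j * b i

lemma dx4_apply (i j k l : Fin 8) (a b c d : E8) :
    dx4 i j k l ![a, b, c, d] =
      plucker a b i j * plucker c d k l - plucker a b i k * plucker c d j l
        + plucker a b i l * plucker c d j k + plucker a b j k * plucker c d i l
        - plucker a b j l * plucker c d i k + plucker a b k l * plucker c d i j := by
  simp [dx4, plucker, Matrix.det_succ_row_zero, Fin.sum_univ_succ, Fin.succAbove]
  ring

lemma Phi_add (a a' b c d : E8) : Phi (a + a') b c d = Phi a b c d + Phi a' b c d := by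
  simp only [Phi, Phi0, dx4_apply, plucker, PiLp.add_apply]
  ring

lemma Phi_smul (r : ℝ) (a b c d : E8) : Phi (r • a) b c d = r * Phi a b c d := by
  simp only [Phi, Phi0, dx4_apply, plucker, PiLp.smul_apply, smul_eq_mul]
  ring

lemma Phi_neg (a b c d : E8) : Phi (-a) b c d = -Phi a b c d := by
  simpa using Phi_smul (-1) a b c d

lemma Phi_swap_first (a b c d : E8) : Phi b a c d = -Phi a b c d := by
  simp only [Phi, Phi0, dx4_apply, plucker]
  ring

lemma Phi_swap_middle (a b c d : E8) : Phi a c b d = -Phi a b c d := by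
  simp only [Phi, Phi0, dx4_apply, plucker]
  ring

lemma Phi_swap_last (a b c d : E8) : Phi a b d c = -Phi a b c d := by
  simp only [Phi, Phi0, dx4_apply, plucker]
  ring

lemma Phi_add_second (a b b' c d : E8) : Phi a (b + b') c d = Phi a b c d + Phi a b' c d := by
  simp only [Phi, Phi0, dx4_apply, plucker, PiLp.add_apply]
  ring

lemma Phi_add_third (a b c c' d : E8) : Phi a b (c + c') d = Phi a b c d + Phi a b c' d := by
  simp only [Phi, Phi0, dx4_apply, plucker, PiLp.add_apply]
  ring

lemma Phi_smul_second (r : ℝ) (a b c d : E8) : Phi a (r • b) c d = r * Phi a b c d := by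
  simp only [Phi, Phi0, dx4_apply, plucker, PiLp.smul_apply, smul_eq_mul]
  ring

lemma Phi_smul_third (r : ℝ) (a b c d : E8) : Phi a b (r • c) d = r * Phi a b c d := by
  simp only [Phi, Phi0, dx4_apply, plucker, PiLp.smul_apply, smul_eq_mul]
  ring

lemma stdB_apply (i j : Fin 8) : stdB i j = if j = i then 1 else 0 := by
  simp [stdB]

lemma inner_stdB_right (a : E8) (i : Fin 8) : (⟪a, stdB i⟫ : ℝ) = a i := by
  simp [stdB, PiLp.inner_apply]

lemma crossTriple_apply (u v w : E8) (i : Fin 8) :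
    crossTriple u v w i = Phi (stdB i) u v w := rfl

lemma eq_sum_smul_stdB (x : E8) : x = ∑ i, x i • stdB i := by
  ext j
  simp [stdB_apply]

lemma inner_crossTriple (x u v w : E8) : (⟪x, crossTriple u v w⟫ : ℝ) = Phi x u v w := by
  conv_rhs => rw [eq_sum_smul_stdB x]
  simp only [PiLp.inner_apply, crossTriple_apply, Fin.sum_univ_eight, Phi_add, Phi_smul]
  simp [mul_comm]

/-- An alternating trilinear function on `ℝ⁸` vanishes if it vanishes on increasing triples of
standard basis vectors. -/
lemma eq_zero_of_alternating {D : E8 → E8 → E8 → ℝ}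
    (hadd : ∀ u u' v w, D (u + u') v w = D u v w + D u' v w)
    (hsmul : ∀ (r : ℝ) u v w, D (r • u) v w = r * D u v w)
    (h₁ : ∀ u v w, D v u w = -D u v w) (h₂ : ∀ u v w, D u w v = -D u v w)
    (h : ∀ i j k : Fin 8, i < j → j < k → D (stdB i) (stdB j) (stdB k) = 0) (u v w : E8) :
    D u v w = 0 := by
  have basis (i j k : Fin 8) : D (stdB i) (stdB j) (stdB k) = 0 := by
    rcases lt_trichotomy i j with hij | hij | hij <;>
    rcases lt_trichotomy j k with hjk | hjk | hjk <;>
    rcases lt_trichotomy i k with hik | hik | hik <;>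
    grind
  have extend {F : E8 → ℝ} (ha : ∀ x y, F (x + y) = F x + F y)
      (hs : ∀ (r : ℝ) x, F (r • x) = r * F x) (h0 : ∀ i, F (stdB i) = 0) (x : E8) : F x = 0 := by
    rw [eq_sum_smul_stdB x]
    simp [Fin.sum_univ_eight, ha, hs, h0]
  refine extend (F := fun x => D x v w) (fun x y => hadd x y v w) (fun r x => hsmul r x v w)
    (fun i => ?_) u
  rw [← neg_eq_zero, ← h₁]
  refine extend (F := fun x => D x (stdB i) w) (fun x y => hadd x y _ w)
    (fun r x => hsmul r x _ w) (fun j => ?_) v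
  rw [h₁, neg_eq_zero, ← neg_eq_zero, ← h₂, ← neg_eq_zero, ← h₁]
  refine extend (F := fun x => D x (stdB i) (stdB j)) (fun x y => hadd x y _ _)
    (fun r x => hsmul r x _ _) (fun k => basis k i j) w

/-- The inner product `⟪a × b × c, u × v × w⟫` in terms of inner products of the factors and of the
Cayley form. -/
def crossInner (a b c u v w : E8) : ℝ :=
  ⟪a, u⟫ * (⟪b, v⟫ * ⟪c, w⟫ - ⟪b, w⟫ * ⟪c, v⟫)
    - ⟪a, v⟫ * (⟪b, u⟫ * ⟪c, w⟫ - ⟪b, w⟫ * ⟪c, u⟫)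
    + ⟪a, w⟫ * (⟪b, u⟫ * ⟪c, v⟫ - ⟪b, v⟫ * ⟪c, u⟫)
    - (⟪a, u⟫ * Phi b c v w - ⟪a, v⟫ * Phi b c u w + ⟪a, w⟫ * Phi b c u v
      - ⟪b, u⟫ * Phi a c v w + ⟪b, v⟫ * Phi a c u w - ⟪b, w⟫ * Phi a c u v
      + ⟪c, u⟫ * Phi a b v w - ⟪c, v⟫ * Phi a b u w + ⟪c, w⟫ * Phi a b u v)

lemma Phi_swap_pairs (a b c d : E8) : Phi a b c d = Phi c d a b := by
  simp only [Phi, Phi0, dx4_apply]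
  ring

lemma Phi_self_first (a c d : E8) : Phi a a c d = 0 := by
  linarith [Phi_swap_first a a c d]

lemma plucker_stdB {i j : Fin 8} (hij : i < j) {k l : Fin 8} (hkl : k < l) :
    plucker (stdB i) (stdB j) k l = if k = i ∧ l = j then 1 else 0 := by
  simp only [plucker, stdB_apply]
  split_ifs <;> grind

/-- The matrix of `2`-forms `Φ₀(u_i, u_j, ·, ·)`, in terms of Plücker coordinates. -/
def cayleyContraction (p : Fin 8 → Fin 8 → ℝ) : Fin 8 → Fin 8 → ℝ :=
  ![
    ![0, p 2 3 + p 4 5 - p 6 7, -p 1 3 + p 4 6 + p 5 7, p 1 2 + p 4 7 - p 5 6,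
      -p 1 5 - p 2 6 - p 3 7, p 1 4 - p 2 7 + p 3 6, p 1 7 + p 2 4 - p 3 5, -p 1 6 + p 2 5 + p 3 4],
    ![-p 2 3 - p 4 5 + p 6 7, 0, p 0 3 - p 4 7 + p 5 6, -p 0 2 + p 4 6 + p 5 7,
      p 0 5 + p 2 7 - p 3 6, -p 0 4 - p 2 6 - p 3 7, -p 0 7 + p 2 5 + p 3 4, p 0 6 - p 2 4 + p 3 5],
    ![p 1 3 - p 4 6 - p 5 7, -p 0 3 + p 4 7 - p 5 6, 0, p 0 1 - p 4 5 + p 6 7,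
      p 0 6 - p 1 7 + p 3 5, p 0 7 + p 1 6 - p 3 4, -p 0 4 - p 1 5 - p 3 7, -p 0 5 + p 1 4 + p 3 6],
    ![-p 1 2 - p 4 7 + p 5 6, p 0 2 - p 4 6 - p 5 7, -p 0 1 + p 4 5 - p 6 7, 0,
      p 0 7 + p 1 6 - p 2 5, -p 0 6 + p 1 7 + p 2 4, p 0 5 - p 1 4 + p 2 7, -p 0 4 - p 1 5 - p 2 6],
    ![p 1 5 + p 2 6 + p 3 7, -p 0 5 - p 2 7 + p 3 6, -p 0 6 + p 1 7 - p 3 5, -p 0 7 - p 1 6 + p 2 5,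
      0, p 0 1 - p 2 3 + p 6 7, p 0 2 + p 1 3 - p 5 7, p 0 3 - p 1 2 + p 5 6],
    ![-p 1 4 + p 2 7 - p 3 6, p 0 4 + p 2 6 + p 3 7, -p 0 7 - p 1 6 + p 3 4, p 0 6 - p 1 7 - p 2 4,
      -p 0 1 + p 2 3 - p 6 7, 0, -p 0 3 + p 1 2 + p 4 7, p 0 2 + p 1 3 - p 4 6],
    ![-p 1 7 - p 2 4 + p 3 5, p 0 7 - p 2 5 - p 3 4, p 0 4 + p 1 5 + p 3 7, -p 0 5 + p 1 4 - p 2 7,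
      -p 0 2 - p 1 3 + p 5 7, p 0 3 - p 1 2 - p 4 7, 0, -p 0 1 + p 2 3 + p 4 5],
    ![p 1 6 - p 2 5 - p 3 4, -p 0 6 + p 2 4 - p 3 5, p 0 5 - p 1 4 - p 3 6, p 0 4 + p 1 5 + p 2 6,
      -p 0 3 + p 1 2 - p 5 6, -p 0 2 - p 1 3 + p 4 6, p 0 1 - p 2 3 - p 4 5, 0]]

lemma cayleyContraction_swap (p : Fin 8 → Fin 8 → ℝ) (i j : Fin 8) :
    cayleyContraction p j i = -cayleyContraction p i j := by
  fin_cases i <;> fin_cases j <;> simp [cayleyContraction] <;> ring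

lemma Phi_stdB_stdB (i j : Fin 8) (c d : E8) :
    Phi (stdB i) (stdB j) c d = cayleyContraction (plucker c d) i j := by
  wlog hij : i < j generalizing i j
  · rcases (not_lt.1 hij).lt_or_eq with h | rfl
    · rw [Phi_swap_first, this j i h, cayleyContraction_swap, neg_neg]
    · rw [Phi_self_first]
      fin_cases j <;> rfl
  simp only [Phi, Phi0, dx4_apply]
  fin_cases i <;> fin_cases j <;> first
    | exact absurd hij (by decide)
    | simp only [Fin.zero_eta, Fin.mk_one, Fin.reduceFinMk, cayleyContraction, Matrix.cons_val]
      simp [plucker_stdB]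
      try ring

lemma crossTriple_apply_eq_sum (a b c : E8) (m : Fin 8) :
    crossTriple a b c m = ∑ j, a j * cayleyContraction (plucker b c) m j := by
  rw [crossTriple_apply, ← neg_neg (Phi _ _ _ _), ← Phi_swap_first]
  conv_lhs => rw [eq_sum_smul_stdB a]
  simp only [Fin.sum_univ_eight, Phi_add, Phi_smul, Phi_stdB_stdB, cayleyContraction_swap _ m]
  ring

set_option maxHeartbeats 8000000 in
lemma Phi_crossTriple_stdB (a b c : E8) {i j k : Fin 8} (hij : i < j) (hjk : j < k) :
    Phi (crossTriple a b c) (stdB i) (stdB j) (stdB k) =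
      crossInner a b c (stdB i) (stdB j) (stdB k) := by
  rw [← neg_neg (Phi _ _ _ _), ← Phi_swap_first, ← Phi_swap_middle]
  simp only [crossInner, inner_stdB_right, Phi_swap_pairs _ _ (stdB _) (stdB _), Phi_stdB_stdB]
  fin_cases i <;> fin_cases j <;> try (exact absurd hij (by decide))
  all_goals fin_cases k <;> try (exact absurd hjk (by decide))
  all_goals
    simp only [Fin.zero_eta, Fin.mk_one, Fin.reduceFinMk, cayleyContraction, Matrix.cons_val]
    simp only [plucker, stdB_apply, Fin.reduceEq, if_true, if_false, mul_zero, mul_one,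
      zero_sub, sub_zero, add_zero, zero_add, neg_neg, neg_zero]
    simp only [crossTriple_apply_eq_sum, Fin.sum_univ_eight, cayleyContraction, Matrix.cons_val,
      plucker]
    ring

/-- The contraction identity for the Cayley form. -/
lemma Phi_crossTriple (a b c u v w : E8) :
    Phi (crossTriple a b c) u v w = crossInner a b c u v w := by
  rw [← sub_eq_zero]
  refine eq_zero_of_alternating
    (D := fun u v w => Phi (crossTriple a b c) u v w - crossInner a b c u v w)
    (fun u u' v w => ?_) (fun r u v w => ?_) (fun u v w => ?_) (fun u v w => ?_)
    (fun i j k hij hjk => sub_eq_zero.2 (Phi_crossTriple_stdB a b c hij hjk)) u v w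
  · simp only [crossInner, inner_add_right, Phi_add_second, Phi_add_third]
    ring
  · simp only [crossInner, inner_smul_right, Phi_smul_second, Phi_smul_third]
    ring
  · simp only [crossInner, Phi_swap_middle _ u v, Phi_swap_last _ _ u v]
    ring
  · simp only [crossInner, Phi_swap_last _ _ v w]
    ring

lemma Phi_self_middle (a b d : E8) : Phi a b b d = 0 := by
  linarith [Phi_swap_middle a b b d]

lemma Phi_self_first_third (a b d : E8) : Phi a b a d = 0 := by
  rw [Phi_swap_middle, Phi_self_first, neg_zero]

lemma Phi_self_second_last (a b c : E8) : Phi a b c b = 0 := by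
  rw [Phi_swap_last, Phi_self_middle, neg_zero]

lemma Phi_self_first_last (a b c : E8) : Phi a b c a = 0 := by
  rw [Phi_swap_last, Phi_self_first_third, neg_zero]

lemma inner_crossTriple_left (x u v w : E8) : (⟪crossTriple u v w, x⟫ : ℝ) = Phi x u v w := by
  rw [real_inner_comm, inner_crossTriple]

/-- An alternating function of four indices vanishes if its values involving an index outside
`{0, 1, 2, 4}` are controlled by values with two indices in `{0, 1, 2, 4}`. -/
lemma eq_zero_of_contraction {G : Fin 8 → Fin 8 → Fin 8 → Fin 8 → ℝ}
    (h₁ : ∀ i j k l, G j i k l = -G i j k l) (h₂ : ∀ i j k l, G i k j l = -G i j k l)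
    (h₃ : ∀ i j k l, G i j l k = -G i j k l) (h : G 0 1 2 4 = 0)
    (hrec : ∀ x ∉ ({0, 1, 2, 4} : Finset (Fin 8)), ∀ y z w,
      (∀ p ∈ ({0, 1, 2, 4} : Finset (Fin 8)), ∀ q ∈ ({0, 1, 2, 4} : Finset (Fin 8)),
        G p q z w = 0 ∧ G p q y w = 0 ∧ G p q y z = 0) → G x y z w = 0)
    (i j k l : Fin 8) : G i j k l = 0 := by
  have four : ∀ p ∈ ({0, 1, 2, 4} : Finset (Fin 8)), ∀ q ∈ ({0, 1, 2, 4} : Finset (Fin 8)),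
      ∀ r ∈ ({0, 1, 2, 4} : Finset (Fin 8)), ∀ s ∈ ({0, 1, 2, 4} : Finset (Fin 8)),
      G p q r s = 0 := by
    have s₁ {i j : Fin 8} (_ : j < i) (k l : Fin 8) : G i j k l = -G j i k l := h₁ _ _ _ _
    have s₂ {j k : Fin 8} (_ : k < j) (i l : Fin 8) : G i j k l = -G i k j l := h₂ _ _ _ _
    have s₃ {k l : Fin 8} (_ : l < k) (i j : Fin 8) : G i j k l = -G i j l k := h₃ _ _ _ _
    have e₁ (i k l : Fin 8) : G i i k l = 0 := by linarith [h₁ i i k l]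
    have e₂ (i j l : Fin 8) : G i j j l = 0 := by linarith [h₂ i j j l]
    have e₃ (i j k : Fin 8) : G i j k k = 0 := by linarith [h₃ i j k k]
    simp [s₁, s₂, s₃, e₁, e₂, e₃, h]
  have three : ∀ p ∈ ({0, 1, 2, 4} : Finset (Fin 8)), ∀ q ∈ ({0, 1, 2, 4} : Finset (Fin 8)),
      ∀ r ∈ ({0, 1, 2, 4} : Finset (Fin 8)), ∀ w, G p q r w = 0 := by
    intro p hp q hq r hr w
    by_cases hw : w ∈ ({0, 1, 2, 4} : Finset (Fin 8))
    · exact four p hp q hq r hr w hw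
    · rw [h₃, h₂, h₁, neg_neg, neg_eq_zero]
      exact hrec w hw p q r fun a ha b hb =>
        ⟨four a ha b hb q hq r hr, four a ha b hb p hp r hr, four a ha b hb p hp q hq⟩
  have two : ∀ p ∈ ({0, 1, 2, 4} : Finset (Fin 8)), ∀ q ∈ ({0, 1, 2, 4} : Finset (Fin 8)),
      ∀ z w, G p q z w = 0 := by
    intro p hp q hq z w
    by_cases hz : z ∈ ({0, 1, 2, 4} : Finset (Fin 8))
    · exact three p hp q hq z hz w
    · rw [h₂, h₁, neg_neg]
      exact hrec z hz p q w fun a ha b hb =>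
        ⟨three a ha b hb q hq w, three a ha b hb p hp w, three a ha b hb p hp q⟩
  have outside : ∀ x ∉ ({0, 1, 2, 4} : Finset (Fin 8)), ∀ y z w, G x y z w = 0 :=
    fun x hx y z w => hrec x hx y z w fun a ha b hb =>
      ⟨two a ha b hb z w, two a ha b hb y w, two a ha b hb y z⟩
  by_cases hi : i ∈ ({0, 1, 2, 4} : Finset (Fin 8))
  · by_cases hj : j ∈ ({0, 1, 2, 4} : Finset (Fin 8))
    · exact two i hi j hj k l
    · rw [h₁, outside j hj, neg_zero]
  · exact outside i hi j k l

/-- The vectors `e₃, e₅, e₆, e₇` are the signed triple cross products of `e₀, e₁, e₂, e₄`. -/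
def IsCrossCompleted (e : Fin 8 → E8) : Prop :=
  e 3 = -crossTriple (e 0) (e 1) (e 2) ∧ e 5 = -crossTriple (e 0) (e 1) (e 4) ∧
    e 6 = -crossTriple (e 0) (e 2) (e 4) ∧ e 7 = crossTriple (e 1) (e 2) (e 4)

lemma Phi_eq_Phi_of_isCrossCompleted {e e' : Fin 8 → E8} (ho : Orthonormal ℝ e)
    (ho' : Orthonormal ℝ e') (hc : IsCrossCompleted e) (hc' : IsCrossCompleted e')
    (i j k l : Fin 8) : Phi (e i) (e j) (e k) (e l) = Phi (e' i) (e' j) (e' k) (e' l) := by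
  have base {e : Fin 8 → E8} (ho : Orthonormal ℝ e) (hc : IsCrossCompleted e) :
      Phi (e 0) (e 1) (e 2) (e 4) = 0 := by
    rw [← inner_crossTriple, ← hc.2.2.2]
    exact ho.2 (by decide)
  have hinner (i j : Fin 8) : (⟪e i, e j⟫ : ℝ) = ⟪e' i, e' j⟫ := by
    rw [orthonormal_iff_ite.1 ho, orthonormal_iff_ite.1 ho']
  rw [← sub_eq_zero]
  refine eq_zero_of_contraction
    (G := fun i j k l => Phi (e i) (e j) (e k) (e l) - Phi (e' i) (e' j) (e' k) (e' l))
    (fun i j k l => ?_) (fun i j k l => ?_) (fun i j k l => ?_) ?_ ?_ i j k l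
  · rw [Phi_swap_first, Phi_swap_first (e' i)]
    ring
  · rw [Phi_swap_middle, Phi_swap_middle (e' i)]
    ring
  · rw [Phi_swap_last, Phi_swap_last (e' i)]
    ring
  · rw [base ho hc, base ho' hc', sub_zero]
  · intro x hx y z w H
    simp only [sub_eq_zero] at H ⊢
    have hcross : ∀ a ∈ ({0, 1, 2, 4} : Finset (Fin 8)), ∀ b ∈ ({0, 1, 2, 4} : Finset (Fin 8)),
        ∀ c ∈ ({0, 1, 2, 4} : Finset (Fin 8)),
        Phi (crossTriple (e a) (e b) (e c)) (e y) (e z) (e w) =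
          Phi (crossTriple (e' a) (e' b) (e' c)) (e' y) (e' z) (e' w) := by
      intro a ha b hb c hc
      simp only [Phi_crossTriple, crossInner, hinner, H a ha b hb, H a ha c hc, H b hb c hc]
    obtain ⟨h3, h5, h6, h7⟩ := hc
    obtain ⟨h3', h5', h6', h7'⟩ := hc'
    have : x = 3 ∨ x = 5 ∨ x = 6 ∨ x = 7 := by
      revert x
      decide
    rcases this with rfl | rfl | rfl | rfl
    · rw [h3, h3', Phi_neg, Phi_neg, hcross] <;> decide
    · rw [h5, h5', Phi_neg, Phi_neg, hcross] <;> decide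
    · rw [h6, h6', Phi_neg, Phi_neg, hcross] <;> decide
    · rw [h7, h7', hcross] <;> decide

lemma orthonormal_stdB : Orthonormal ℝ stdB :=
  EuclideanSpace.orthonormal_single

lemma isCrossCompleted_stdB : IsCrossCompleted stdB := by
  refine ⟨?_, ?_, ?_, ?_⟩ <;> ext m <;>
    simp only [PiLp.neg_apply, crossTriple_apply, Phi_stdB_stdB] <;> fin_cases m <;>
    simp [cayleyContraction, plucker, stdB_apply]

lemma orthonormal_of_crossTriple {e₁ e₂ e₃ e₅ : E8}
    (h123 : Orthonormal ℝ ![e₁, e₂, e₃]) (h5 : ‖e₅‖ = 1)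
    (h51 : (⟪e₅, e₁⟫ : ℝ) = 0) (h52 : (⟪e₅, e₂⟫ : ℝ) = 0) (h53 : (⟪e₅, e₃⟫ : ℝ) = 0)
    (h5c : (⟪e₅, crossTriple e₁ e₂ e₃⟫ : ℝ) = 0) :
    Orthonormal ℝ ![e₁, e₂, e₃, -(crossTriple e₁ e₂ e₃), e₅,
      -(crossTriple e₁ e₂ e₅), -(crossTriple e₁ e₃ e₅), crossTriple e₂ e₃ e₅] := by
  have h (i j : Fin 3) := orthonormal_iff_ite.1 h123 i j
  have h11 : (⟪e₁, e₁⟫ : ℝ) = 1 := h 0 0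
  have h22 : (⟪e₂, e₂⟫ : ℝ) = 1 := h 1 1
  have h33 : (⟪e₃, e₃⟫ : ℝ) = 1 := h 2 2
  have h12 : (⟪e₁, e₂⟫ : ℝ) = 0 := h 0 1
  have h13 : (⟪e₁, e₃⟫ : ℝ) = 0 := h 0 2
  have h23 : (⟪e₂, e₃⟫ : ℝ) = 0 := h 1 2
  have h21 : (⟪e₂, e₁⟫ : ℝ) = 0 := h 1 0
  have h31 : (⟪e₃, e₁⟫ : ℝ) = 0 := h 2 0
  have h32 : (⟪e₃, e₂⟫ : ℝ) = 0 := h 2 1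
  have h55 : (⟪e₅, e₅⟫ : ℝ) = 1 := by rw [real_inner_self_eq_norm_sq, h5, one_pow]
  have h15 : (⟪e₁, e₅⟫ : ℝ) = 0 := by rw [real_inner_comm, h51]
  have h25 : (⟪e₂, e₅⟫ : ℝ) = 0 := by rw [real_inner_comm, h52]
  have h35 : (⟪e₃, e₅⟫ : ℝ) = 0 := by rw [real_inner_comm, h53]
  have p5 : Phi e₅ e₁ e₂ e₃ = 0 := by rw [← inner_crossTriple, h5c]
  have p1 : Phi e₁ e₂ e₃ e₅ = 0 := by
    rw [Phi_swap_last, Phi_swap_middle, Phi_swap_first, p5]; simp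
  have p2 : Phi e₂ e₁ e₃ e₅ = 0 := by rw [Phi_swap_first, p1, neg_zero]
  have p3 : Phi e₃ e₁ e₂ e₅ = 0 := by rw [Phi_swap_first, Phi_swap_middle, p1]; simp
  rw [orthonormal_iff_ite]
  intro i j
  fin_cases i <;> fin_cases j <;>
    simp [-inner_self_eq_norm_sq_to_K, inner_crossTriple, inner_crossTriple_left, Phi_crossTriple,
      crossInner, Phi_self_first, Phi_self_middle, Phi_self_first_third,
      Phi_self_second_last, Phi_self_first_last, h11, h22, h33, h12, h13, h23, h21, h31, h32,
      h55, h15, h25, h35, h51, h52, h53, p1, p2, p3, p5]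

/-- The alternating form `dx_{ijkl}`. -/
def dx4Form (i j k l : Fin 8) : E8 [⋀^Fin 4]→ₗ[ℝ] ℝ :=
  Matrix.detRowAlternating.compLinearMap
    (LinearMap.funLeft ℝ ℝ ![i, j, k, l] ∘ₗ (WithLp.linearEquiv 2 ℝ (Fin 8 → ℝ)).toLinearMap)

lemma dx4Form_apply (i j k l : Fin 8) (v : Fin 4 → E8) : dx4Form i j k l v = dx4 i j k l v :=
  Matrix.det_transpose (Matrix.of fun r s : Fin 4 => v s (![i, j, k, l] r))

/-- The Cayley form as an alternating map. -/
def cayleyForm : E8 [⋀^Fin 4]→ₗ[ℝ] ℝ :=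
  dx4Form 0 1 2 3 + dx4Form 0 1 4 5 - dx4Form 0 1 6 7 + dx4Form 0 2 4 6 + dx4Form 0 2 5 7
    + dx4Form 0 3 4 7 - dx4Form 0 3 5 6 - dx4Form 1 2 4 7 + dx4Form 1 2 5 6 + dx4Form 1 3 4 6
    + dx4Form 1 3 5 7 - dx4Form 2 3 4 5 + dx4Form 2 3 6 7 + dx4Form 4 5 6 7

lemma cayleyForm_apply (v : Fin 4 → E8) : cayleyForm v = Phi0 v := by
  simp only [cayleyForm, AlternatingMap.add_apply, AlternatingMap.sub_apply, dx4Form_apply, Phi0]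

lemma Phi_map_of_orthonormal (b : OrthonormalBasis (Fin 8) ℝ E8)
    (hb : ∀ i j k l, Phi (b i) (b j) (b k) (b l) = Phi (stdB i) (stdB j) (stdB k) (stdB l))
    (x y z w : E8) : Phi (b.repr x) (b.repr y) (b.repr z) (b.repr w) = Phi x y z w := by
  have hcons {α β : Type} (f : α → β) (p q r s : α) :
      (fun i => f (![p, q, r, s] i)) = ![f p, f q, f r, f s] := by
    ext i : 1
    fin_cases i <;> rfl
  have h : cayleyForm.compLinearMap b.repr.toLinearEquiv.toLinearMap = cayleyForm := by
    refine Module.Basis.ext_alternating b.toBasis fun v _ => ?_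
    have hv (e : Fin 8 → E8) : (fun s => e (v s)) = ![e (v 0), e (v 1), e (v 2), e (v 3)] := by
      ext s : 1
      fin_cases s <;> rfl
    have := hb (v 0) (v 1) (v 2) (v 3)
    simp only [Phi, ← hv] at this
    simpa [cayleyForm_apply, stdB, Function.comp_def] using this.symm
  have := congrArg (fun f => f ![x, y, z, w]) h
  simp only [AlternatingMap.compLinearMap_apply, cayleyForm_apply, hcons] at this
  exact this

lemma eq_stdB_of_isSpin7Frame {a b c d : E8}
    (h : IsSpin7Frame ![stdB 0, stdB 1, stdB 2, a, stdB 4, b, c, d]) :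
    a = stdB 3 ∧ b = stdB 5 ∧ c = stdB 6 ∧ d = stdB 7 := by
  have h0123 := h 0 1 2 3 (by decide) (by decide) (by decide)
  have h0125 := h 0 1 2 5 (by decide) (by decide) (by decide)
  have h0126 := h 0 1 2 6 (by decide) (by decide) (by decide)
  have h0127 := h 0 1 2 7 (by decide) (by decide) (by decide)
  have h0134 := h 0 1 3 4 (by decide) (by decide) (by decide)
  have h0145 := h 0 1 4 5 (by decide) (by decide) (by decide)
  have h0146 := h 0 1 4 6 (by decide) (by decide) (by decide)
  have h0147 := h 0 1 4 7 (by decide) (by decide) (by decide)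
  have h0234 := h 0 2 3 4 (by decide) (by decide) (by decide)
  have h0245 := h 0 2 4 5 (by decide) (by decide) (by decide)
  have h0246 := h 0 2 4 6 (by decide) (by decide) (by decide)
  have h0247 := h 0 2 4 7 (by decide) (by decide) (by decide)
  have h1234 := h 1 2 3 4 (by decide) (by decide) (by decide)
  have h1245 := h 1 2 4 5 (by decide) (by decide) (by decide)
  have h1246 := h 1 2 4 6 (by decide) (by decide) (by decide)
  have h1247 := h 1 2 4 7 (by decide) (by decide) (by decide)
  simp [Phi_stdB_stdB, cayleyContraction, plucker, stdB_apply]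
    at h0123 h0125 h0126 h0127 h0134 h0145 h0146 h0147 h0234 h0245 h0246 h0247
      h1234 h1245 h1246 h1247
  have h0136 := h 0 1 3 6 (by decide) (by decide) (by decide)
  have h0137 := h 0 1 3 7 (by decide) (by decide) (by decide)
  have h0156 := h 0 1 5 6 (by decide) (by decide) (by decide)
  have h0157 := h 0 1 5 7 (by decide) (by decide) (by decide)
  have h0235 := h 0 2 3 5 (by decide) (by decide) (by decide)
  have h0237 := h 0 2 3 7 (by decide) (by decide) (by decide)
  have h0256 := h 0 2 5 6 (by decide) (by decide) (by decide)
  have h1235 := h 1 2 3 5 (by decide) (by decide) (by decide)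
  have h1236 := h 1 2 3 6 (by decide) (by decide) (by decide)
  have h0135 := h 0 1 3 5 (by decide) (by decide) (by decide)
  have h0236 := h 0 2 3 6 (by decide) (by decide) (by decide)
  have h1237 := h 1 2 3 7 (by decide) (by decide) (by decide)
  have h0456 := h 0 4 5 6 (by decide) (by decide) (by decide)
  simp [Phi_stdB_stdB, cayleyContraction, plucker, stdB_apply, h0123, h0125, h0126, h0127, h0134,
    h0145, h0146, h0147, h0234, h0245, h0246, h0247, h1234, h1245, h1246, h1247]
    at h0136 h0137 h0156 h0157 h0235 h0237 h0256 h1235 h1236 h0135 h0236 h1237 h0456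
  have h0345 := h 0 3 4 5 (by decide) (by decide) (by decide)
  have h0346 := h 0 3 4 6 (by decide) (by decide) (by decide)
  have h1345 := h 1 3 4 5 (by decide) (by decide) (by decide)
  simp [Phi_swap_middle _ (stdB 4), Phi_stdB_stdB, cayleyContraction, plucker, stdB_apply, h0123,
    h0125, h0126, h0134, h0145, h0146, h0234, h0245, h0246, h1234, h1245, h1246]
    at h0345 h0346 h1345
  have ha4 : a 4 = 0 := by linarith
  have hb2 : b 2 = 0 := by linarith
  have hc1 : c 1 = 0 := by linarith
  have hd0 : d 0 = 0 := by linarith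
  refine ⟨?_, ?_, ?_, ?_⟩ <;> ext m <;> fin_cases m <;> simp [stdB_apply, *]

/-- Completion of suitable orthonormal vectors `e₁,e₂,e₃,e₅` to a `Spin(7)`-frame
`(e₁,…,e₈)` with `e₄ = −e₁×e₂×e₃`, `e₆ = −e₁×e₂×e₅`, `e₇ = −e₁×e₃×e₅`,
`e₈ = e₂×e₃×e₅`, and uniqueness of the completion. -/
theorem spin7_frame_completion (e₁ e₂ e₃ e₅ : E8)
    (h123 : Orthonormal ℝ ![e₁, e₂, e₃]) (h5 : ‖e₅‖ = 1)
    (h51 : (⟪e₅, e₁⟫ : ℝ) = 0) (h52 : (⟪e₅, e₂⟫ : ℝ) = 0) (h53 : (⟪e₅, e₃⟫ : ℝ) = 0)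
    (h5c : (⟪e₅, crossTriple e₁ e₂ e₃⟫ : ℝ) = 0) :
    Orthonormal ℝ ![e₁, e₂, e₃, -(crossTriple e₁ e₂ e₃), e₅,
        -(crossTriple e₁ e₂ e₅), -(crossTriple e₁ e₃ e₅), crossTriple e₂ e₃ e₅] ∧
    Submodule.span ℝ (Set.range ![e₁, e₂, e₃, -(crossTriple e₁ e₂ e₃), e₅,
        -(crossTriple e₁ e₂ e₅), -(crossTriple e₁ e₃ e₅), crossTriple e₂ e₃ e₅]) = ⊤ ∧
    IsSpin7Frame ![e₁, e₂, e₃, -(crossTriple e₁ e₂ e₃), e₅,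
        -(crossTriple e₁ e₂ e₅), -(crossTriple e₁ e₃ e₅), crossTriple e₂ e₃ e₅] ∧
    ∀ f₄ f₆ f₇ f₈ : E8,
      LinearIndependent ℝ ![e₁, e₂, e₃, f₄, e₅, f₆, f₇, f₈] →
      IsSpin7Frame ![e₁, e₂, e₃, f₄, e₅, f₆, f₇, f₈] →
      f₄ = -(crossTriple e₁ e₂ e₃) ∧ f₆ = -(crossTriple e₁ e₂ e₅) ∧
        f₇ = -(crossTriple e₁ e₃ e₅) ∧ f₈ = crossTriple e₂ e₃ e₅ := by
  set e : Fin 8 → E8 := ![e₁, e₂, e₃, -(crossTriple e₁ e₂ e₃), e₅,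
    -(crossTriple e₁ e₂ e₅), -(crossTriple e₁ e₃ e₅), crossTriple e₂ e₃ e₅]
  have ho : Orthonormal ℝ e := orthonormal_of_crossTriple h123 h5 h51 h52 h53 h5c
  have hspan : Submodule.span ℝ (Set.range e) = ⊤ :=
    ho.linearIndependent.span_eq_top_of_card_eq_finrank' (by simp)
  have hPhi := Phi_eq_Phi_of_isCrossCompleted ho orthonormal_stdB ⟨rfl, rfl, rfl, rfl⟩
    isCrossCompleted_stdB
  refine ⟨ho, hspan, fun i j k l _ _ _ => hPhi i j k l, fun f₄ f₆ f₇ f₈ _ hf => ?_⟩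
  obtain ⟨b, hb⟩ : ∃ b : OrthonormalBasis (Fin 8) ℝ E8, ∀ i, b i = e i :=
    ⟨OrthonormalBasis.mk ho hspan.ge, by simp⟩
  have hrepr (i : Fin 8) : b.repr (e i) = stdB i := by rw [← hb, b.repr_self, stdB]
  have hmap := Phi_map_of_orthonormal b (by simpa only [hb] using hPhi)
  have hframe : IsSpin7Frame fun i => b.repr (![e₁, e₂, e₃, f₄, e₅, f₆, f₇, f₈] i) := by
    intro i j k l hij hjk hkl
    rw [hmap]
    exact hf i j k l hij hjk hkl
  have h1 : b.repr e₁ = stdB 0 := hrepr 0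
  have h2 : b.repr e₂ = stdB 1 := hrepr 1
  have h3 : b.repr e₃ = stdB 2 := hrepr 2
  have h5 : b.repr e₅ = stdB 4 := hrepr 4
  have heq : (fun i => b.repr (![e₁, e₂, e₃, f₄, e₅, f₆, f₇, f₈] i)) =
      ![stdB 0, stdB 1, stdB 2, b.repr f₄, stdB 4, b.repr f₆, b.repr f₇, b.repr f₈] := by
    funext i
    fin_cases i <;> simp [h1, h2, h3, h5]
  rw [heq] at hframe
  obtain ⟨h₄, h₆, h₇, h₈⟩ := eq_stdB_of_isSpin7Frame hframe
  simp only [← hrepr, EmbeddingLike.apply_eq_iff_eq] at h₄ h₆ h₇ h₈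
  exact ⟨h₄, h₆, h₇, h₈⟩

end
end

section
/- Let H := u₁ᗮ ⊆ ℝ⁸ be the hyperplane orthogonal to the first standard basis vector, carrying the G₂ 3-form φ₀(x,y,z) := Φ₀(u₁,x,y,z). Let A ⊆ H be a 3-dimensional associative subspace, i.e. A admits an orthonormal basis (a₁,a₂,a₃) with φ₀(a₁,a₂,a₃) = 1; let C ⊆ H be a 4-dimensional coassociative subspace, i.e. φ₀(x,y,z) = 0 for all x, y, z ∈ C; and let P ⊆ A ∩ C be a 2-dimensional subspace. Then every vector u ∈ A orthogonal to P is orthogonal to C. (This is the pointwise linear-algebra core of the statement that an associative submanifold with boundary in a coassociative submanifold meets it orthogonally.) -/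
open scoped RealInnerProductSpace

noncomputable section

lemma dx4_zero_stdB_zero (j k l : Fin 8) (hj : j ≠ 0) (hk : k ≠ 0) (hl : l ≠ 0) (x y z : E8) :
    dx4 0 j k l ![stdB 0, x, y, z] =
      x j * (y k * z l - y l * z k) - x k * (y j * z l - y l * z j)
        + x l * (y j * z k - y k * z j) := by
  rw [dx4, Matrix.det_succ_column_zero]
  simp [Fin.sum_univ_four, stdB, hj, hk, hl, Matrix.det_fin_three, Fin.succAbove]
  ring

lemma dx4_stdB_zero_eq_zero (i j k l : Fin 8) (hi : i ≠ 0) (hj : j ≠ 0) (hk : k ≠ 0)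
    (hl : l ≠ 0) (x y z : E8) : dx4 i j k l ![stdB 0, x, y, z] = 0 := by
  apply Matrix.det_eq_zero_of_column_eq_zero 0
  intro r
  fin_cases r <;> simp [stdB, hi, hj, hk, hl]

/-- The `G₂` 3-form `Φ₀(u₁, x, y, z)` in coordinates. -/
lemma Phi_stdB_zero (x y z : E8) : Phi (stdB 0) x y z =
    (x 1 * (y 2 * z 3 - y 3 * z 2) - x 2 * (y 1 * z 3 - y 3 * z 1)
      + x 3 * (y 1 * z 2 - y 2 * z 1))
    + (x 1 * (y 4 * z 5 - y 5 * z 4) - x 4 * (y 1 * z 5 - y 5 * z 1)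
      + x 5 * (y 1 * z 4 - y 4 * z 1))
    - (x 1 * (y 6 * z 7 - y 7 * z 6) - x 6 * (y 1 * z 7 - y 7 * z 1)
      + x 7 * (y 1 * z 6 - y 6 * z 1))
    + (x 2 * (y 4 * z 6 - y 6 * z 4) - x 4 * (y 2 * z 6 - y 6 * z 2)
      + x 6 * (y 2 * z 4 - y 4 * z 2))
    + (x 2 * (y 5 * z 7 - y 7 * z 5) - x 5 * (y 2 * z 7 - y 7 * z 2)
      + x 7 * (y 2 * z 5 - y 5 * z 2))
    + (x 3 * (y 4 * z 7 - y 7 * z 4) - x 4 * (y 3 * z 7 - y 7 * z 3)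
      + x 7 * (y 3 * z 4 - y 4 * z 3))
    - (x 3 * (y 5 * z 6 - y 6 * z 5) - x 5 * (y 3 * z 6 - y 6 * z 3)
      + x 6 * (y 3 * z 5 - y 5 * z 3)) := by
  simp only [Phi, Phi0]
  repeat rw [dx4_zero_stdB_zero _ _ _ (by decide) (by decide) (by decide)]
  repeat rw [dx4_stdB_zero_eq_zero _ _ _ _ (by decide) (by decide) (by decide) (by decide)]
  ring

/-- The inner product of `ℝ⁸` in coordinates. -/
lemma inner_eq_coord (x y : E8) : (⟪x, y⟫ : ℝ) =
    x 0 * y 0 + x 1 * y 1 + x 2 * y 2 + x 3 * y 3 + x 4 * y 4 + x 5 * y 5 + x 6 * y 6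
      + x 7 * y 7 := by
  simp only [PiLp.inner_apply, Fin.sum_univ_eight, RCLike.inner_apply, conj_trivial]
  ring

/-- The `G₂` cross product, dual to `Φ₀(u₁, a, b, ·)`. -/
def crossG2 (a b : E8) : E8 :=
  (EuclideanSpace.equiv (Fin 8) ℝ).symm fun i => Phi (stdB 0) a b (stdB i)

lemma crossG2_apply (a b : E8) (i : Fin 8) :
    crossG2 a b i = Phi (stdB 0) a b (stdB i) := rfl

lemma inner_crossG2 (a b c : E8) : (⟪crossG2 a b, c⟫ : ℝ) = Phi (stdB 0) a b c := by
  rw [inner_eq_coord]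
  simp only [crossG2_apply, Phi_stdB_zero]
  simp [stdB]
  ring

/-- The Lagrange identity for the `G₂` cross product on the hyperplane orthogonal to `u₁`. -/
lemma inner_crossG2_self {a b : E8} (ha : a 0 = 0) (hb : b 0 = 0) :
    (⟪crossG2 a b, crossG2 a b⟫ : ℝ) = ⟪a, a⟫ * ⟪b, b⟫ - ⟪a, b⟫ ^ 2 := by
  simp only [inner_eq_coord, crossG2_apply, Phi_stdB_zero]
  simp [stdB, ha, hb]
  ring

lemma Phi_stdB_zero_cyclic (x y z : E8) : Phi (stdB 0) x y z = Phi (stdB 0) y z x := by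
  simp only [Phi_stdB_zero]; ring

/-- If an orthonormal triple `a, b, e` with `a, b ⊥ u₁` is calibrated by the `G₂` form, then
contracting the form with `a, b` gives the functional dual to `e`. -/
lemma Phi_eq_inner_of_calibrated {a b e : E8} (ha : a 0 = 0) (hb : b 0 = 0)
    (haa : (⟪a, a⟫ : ℝ) = 1) (hbb : (⟪b, b⟫ : ℝ) = 1) (hab : (⟪a, b⟫ : ℝ) = 0)
    (hee : (⟪e, e⟫ : ℝ) = 1) (h : Phi (stdB 0) a b e = 1) (c : E8) :
    Phi (stdB 0) a b c = ⟪e, c⟫ := by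
  have hw := inner_crossG2_self ha hb
  have hwe := inner_crossG2 a b e
  have hz : (⟪crossG2 a b - e, crossG2 a b - e⟫ : ℝ) = 0 := by
    rw [real_inner_sub_sub_self, hw, hwe, h, haa, hbb, hab, hee]
    norm_num
  rw [← inner_crossG2, sub_eq_zero.mp (inner_self_eq_zero.mp hz)]

lemma Phi_stdB_zero_comb (a b d c : E8) (p q : Fin 3 → ℝ) :
    Phi (stdB 0) (p 0 • a + p 1 • b + p 2 • d) (q 0 • a + q 1 • b + q 2 • d) c =
      (p 1 * q 2 - p 2 * q 1) * Phi (stdB 0) b d c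
        + (p 2 * q 0 - p 0 * q 2) * Phi (stdB 0) d a c
        + (p 0 * q 1 - p 1 * q 0) * Phi (stdB 0) a b c := by
  simp only [Phi_stdB_zero, PiLp.add_apply, PiLp.smul_apply, smul_eq_mul]
  ring

/-- In `ℝ³`, a vector orthogonal to an orthonormal pair `p, q` is orthogonal to every vector
orthogonal to `p × q`. -/
lemma dot_eq_zero_of_dot_cross_eq_zero (p q u c : Fin 3 → ℝ)
    (hpp : p 0 * p 0 + p 1 * p 1 + p 2 * p 2 = 1)
    (hqq : q 0 * q 0 + q 1 * q 1 + q 2 * q 2 = 1)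
    (hpq : p 0 * q 0 + p 1 * q 1 + p 2 * q 2 = 0)
    (hup : u 0 * p 0 + u 1 * p 1 + u 2 * p 2 = 0)
    (huq : u 0 * q 0 + u 1 * q 1 + u 2 * q 2 = 0)
    (hc : (p 1 * q 2 - p 2 * q 1) * c 0 + (p 2 * q 0 - p 0 * q 2) * c 1
      + (p 0 * q 1 - p 1 * q 0) * c 2 = 0) :
    u 0 * c 0 + u 1 * c 1 + u 2 * c 2 = 0 := by
  obtain ⟨x, hx⟩ : ∃ x, x = p 1 * q 2 - p 2 * q 1 := ⟨_, rfl⟩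
  obtain ⟨y, hy⟩ : ∃ y, y = p 2 * q 0 - p 0 * q 2 := ⟨_, rfl⟩
  obtain ⟨z, hz⟩ : ∃ z, z = p 0 * q 1 - p 1 * q 0 := ⟨_, rfl⟩
  have hn : x * x + y * y + z * z = 1 := by
    subst hx hy hz
    linear_combination (q 0 * q 0 + q 1 * q 1 + q 2 * q 2) * hpp + hqq
      - (p 0 * q 0 + p 1 * q 1 + p 2 * q 2) * hpq
  have h0 : u 1 * z - u 2 * y = 0 := by
    subst hy hz; linear_combination p 0 * huq - q 0 * hup
  have h1 : u 2 * x - u 0 * z = 0 := by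
    subst hx hz; linear_combination p 1 * huq - q 1 * hup
  have h2 : u 0 * y - u 1 * x = 0 := by
    subst hx hy; linear_combination p 2 * huq - q 2 * hup
  rw [← hx, ← hy, ← hz] at hc
  linear_combination (u 0 * x + u 1 * y + u 2 * z) * hc
    - (u 0 * c 0 + u 1 * c 1 + u 2 * c 2) * hn
    + (c 1 * z - c 2 * y) * h0 + (c 2 * x - c 0 * z) * h1 + (c 0 * y - c 1 * x) * h2

/-- An orthonormal triple in a 3-dimensional subspace spans it. -/
lemma exists_coord_of_orthonormal {A : Submodule ℝ E8} (hA : Module.finrank ℝ A = 3)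
    {a : Fin 3 → E8} (haA : ∀ i, a i ∈ A) (ha : Orthonormal ℝ a) {x : E8} (hx : x ∈ A) :
    ∃ s : Fin 3 → ℝ, x = s 0 • a 0 + s 1 • a 1 + s 2 • a 2 := by
  have hspan : Submodule.span ℝ (Set.range a) = A := by
    apply Submodule.eq_of_le_of_finrank_eq
    · rw [Submodule.span_le]
      rintro _ ⟨i, rfl⟩
      exact haA i
    · rw [finrank_span_eq_card ha.linearIndependent, hA, Fintype.card_fin]
  rw [← hspan, Submodule.mem_span_range_iff_exists_fun] at hx
  obtain ⟨s, rfl⟩ := hx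
  exact ⟨s, Fin.sum_univ_three _⟩

/-- An associative subspace `A ⊆ u₁ᗮ` meets a coassociative subspace `C ⊆ u₁ᗮ`
orthogonally along a 2-dimensional subspace `P ⊆ A ∩ C`: any `u ∈ A` orthogonal to `P`
is orthogonal to `C`.  Here `φ₀(x,y,z) = Φ₀(u₁,x,y,z)` is the `G₂` 3-form on `u₁ᗮ`. -/
theorem associative_meets_coassociative_orthogonally
    (A C P : Submodule ℝ E8)
    (hA1 : ∀ a ∈ A, (⟪a, stdB 0⟫ : ℝ) = 0)
    (hC1 : ∀ c ∈ C, (⟪c, stdB 0⟫ : ℝ) = 0)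
    (hAdim : Module.finrank ℝ A = 3)
    (hAassoc : ∃ a : Fin 3 → E8, (∀ i, a i ∈ A) ∧ Orthonormal ℝ a ∧
      Phi (stdB 0) (a 0) (a 1) (a 2) = 1)
    (hCdim : Module.finrank ℝ C = 4)
    (hCco : ∀ x y z : E8, x ∈ C → y ∈ C → z ∈ C → Phi (stdB 0) x y z = 0)
    (hP : P ≤ A ⊓ C) (hPdim : Module.finrank ℝ P = 2)
    (u : E8) (huA : u ∈ A) (huP : ∀ p ∈ P, (⟪u, p⟫ : ℝ) = 0) :
    ∀ c ∈ C, (⟪u, c⟫ : ℝ) = 0 := by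
  intro c hc
  obtain ⟨a, haA, ha, hcal⟩ := hAassoc
  have hcoord : ∀ i, a i 0 = 0 := fun i => by
    simpa [inner_eq_coord, stdB] using hA1 _ (haA i)
  have hin : ∀ i j, (⟪a i, a j⟫ : ℝ) = if i = j then 1 else 0 := orthonormal_iff_ite.mp ha
  have hdual2 := Phi_eq_inner_of_calibrated (hcoord 0) (hcoord 1) (hin 0 0)
    (hin 1 1) (hin 0 1) (hin 2 2) hcal c
  have hdual0 := Phi_eq_inner_of_calibrated (hcoord 1) (hcoord 2) (hin 1 1)
    (hin 2 2) (hin 1 2) (hin 0 0)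
    ((Phi_stdB_zero_cyclic _ _ _).symm.trans hcal) c
  have hdual1 := Phi_eq_inner_of_calibrated (hcoord 2) (hcoord 0) (hin 2 2)
    (hin 0 0) (hin 2 0) (hin 1 1)
    ((Phi_stdB_zero_cyclic _ _ _).trans hcal) c
  have hdot : ∀ s t : Fin 3 → ℝ,
      (⟪s 0 • a 0 + s 1 • a 1 + s 2 • a 2, t 0 • a 0 + t 1 • a 1 + t 2 • a 2⟫ : ℝ) =
        s 0 * t 0 + s 1 * t 1 + s 2 * t 2 := fun s t => by
    simp [inner_add_left, inner_add_right, inner_smul_left, inner_smul_right, hin, ha.norm_eq_one]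
    ring
  let b := (stdOrthonormalBasis ℝ P).reindex (finCongr hPdim)
  have hb : ∀ i j, (⟪(b i : E8), (b j : E8)⟫ : ℝ) = if i = j then 1 else 0 :=
    orthonormal_iff_ite.mp b.orthonormal
  obtain ⟨p, hp⟩ := exists_coord_of_orthonormal hAdim haA ha (hP (b 0).2).1
  obtain ⟨q, hq⟩ := exists_coord_of_orthonormal hAdim haA ha (hP (b 1).2).1
  obtain ⟨s, rfl⟩ := exists_coord_of_orthonormal hAdim haA ha huA
  have hpp := hb 0 0
  have hqq := hb 1 1
  have hpq := hb 0 1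
  have hup := huP _ (b 0).2
  have huq := huP _ (b 1).2
  have hco := hCco _ _ c (hP (b 0).2).2 (hP (b 1).2).2 hc
  rw [hp, hdot] at hpp hup
  rw [hq, hdot] at hqq huq
  rw [hp, hq, hdot] at hpq
  rw [hp, hq, Phi_stdB_zero_comb, hdual0, hdual1, hdual2] at hco
  have key := dot_eq_zero_of_dot_cross_eq_zero p q s (fun i => ⟪a i, c⟫) (by simpa using hpp)
    (by simpa using hqq) (by simpa using hpq) hup huq hco
  simpa [inner_add_left, inner_smul_left] using key

end
end
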